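/- Let φ be a monotonic nonessential enhancement of range R₀ of site percolation on the square lattice ℤ² and set R = 2R₀. Let ω be a configuration, let x and y be protected sites with B_x(2R) ∩ B_y(2R) = ∅, and suppose there is a closed *-path in ω from x to y. Then there is a closed *-path from x to y in the fully enhanced configuration ω̃. -/

import Mathlib

open MeasureTheory Filter Set Topology
open scoped ENNReal

namespace PercEnh

/-- Sites of the lattice (vertex set `ℤ²`). -/
abbrev Site : Type := ℤ × ℤ

/-- A configuration: the set of open sites. -/
abbrev Config : Type := Set Site

/-- Square-lattice (`ℤ²`-) adjacency: `‖x − y‖₁ = 1`. -/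
def adjZ2 (x y : Site) : Prop := |x.1 - y.1| + |x.2 - y.2| = 1

/-- Matching (star) adjacency: `x ≠ y` and `‖x − y‖_∞ = 1`. -/
def adjStar (x y : Site) : Prop := x ≠ y ∧ max |x.1 - y.1| |x.2 - y.2| = 1

/-- Euclidean norm of a site. -/
noncomputable def siteNorm (x : Site) : ℝ := Real.sqrt ((x.1 : ℝ) ^ 2 + (x.2 : ℝ) ^ 2)

/-- Sites in the closed Euclidean ball of radius `r` centred at the origin. -/
def siteBall (r : ℝ) : Set Site := {x | siteNorm x ≤ r}

/-- The shifted configuration `τ_x ω = {y − x : y ∈ ω}`. -/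
def shiftConfig (x : Site) (ω : Config) : Config := {y | y + x ∈ ω}

/-- An enhancement function of (finite) range `R₀`: takes values in subsets of
`𝔹₀ = ℤ² ∩ B(R₀)` and depends only on the restriction of the configuration to `𝔹₀`. -/
def IsEnhancement (R₀ : ℝ) (φ : Config → Config) : Prop :=
  0 ≤ R₀ ∧ (∀ ω, φ ω ⊆ siteBall R₀) ∧
    ∀ ω ω' : Config, ω ∩ siteBall R₀ = ω' ∩ siteBall R₀ → φ ω = φ ω'

/-- A monotonic enhancement function. -/
def Monotonic (φ : Config → Config) : Prop := ∀ ω ω' : Config, ω ⊆ ω' → φ ω ⊆ φ ω'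

/-- The translate `φ_x(ω) = x + φ₀(τ_x ω)`. -/
def enhAt (φ : Config → Config) (x : Site) (ω : Config) : Config :=
  (fun z => z + x) '' φ (shiftConfig x ω)

/-- The enhanced configuration `ω̂(ω, α) = ω ∪ ⋃_{x : α(x)=1} φ_x(ω)`. -/
def enhanced (φ : Config → Config) (ω : Config) (α : Site → Bool) : Config :=
  ω ∪ {y | ∃ x, α x = true ∧ y ∈ enhAt φ x ω}

/-- The fully (deterministically, with `s = 1`) enhanced configuration `ω̃`. -/
def fullyEnhanced (φ : Config → Config) (ω : Config) : Config :=
  ω ∪ {y | ∃ x, y ∈ enhAt φ x ω}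

/-- `ω` contains a doubly-infinite self-repelling path (w.r.t. adjacency `adj`):
a two-sided sequence of distinct sites of `ω` in which exactly the consecutive
pairs are adjacent. -/
def HasDISRPath (adj : Site → Site → Prop) (ω : Config) : Prop :=
  ∃ γ : ℤ → Site, Function.Injective γ ∧ (∀ i, γ i ∈ ω) ∧
    ∀ i j : ℤ, adj (γ i) (γ j) ↔ (j = i + 1 ∨ i = j + 1)

/-- The enhancement is essential: some configuration without a doubly-infinite
self-repelling path acquires one upon enhancement at the origin. -/
def Essential (adj : Site → Site → Prop) (φ : Config → Config) : Prop :=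
  ∃ ω : Config, ¬ HasDISRPath adj ω ∧ HasDISRPath adj (ω ∪ φ ω)

/-- A (finite, nonempty) path w.r.t. adjacency `adj`: distinct sites,
consecutive ones adjacent. -/
def IsPathOn (adj : Site → Site → Prop) (l : List Site) : Prop :=
  l ≠ [] ∧ l.Nodup ∧ l.Chain' adj

/-- `x` and `y` are joined by a path of sites of `ω`. -/
def ConnectedIn (adj : Site → Site → Prop) (ω : Config) (x y : Site) : Prop :=
  ∃ l : List Site, IsPathOn adj l ∧ (∀ z ∈ l, z ∈ ω) ∧
    l.head? = some x ∧ l.getLast? = some y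

/-- `x` belongs to an infinite open cluster of `ω`. -/
def InInfiniteCluster (adj : Site → Site → Prop) (ω : Config) (x : Site) : Prop :=
  {y | ConnectedIn adj ω x y}.Infinite

/-- `ω` contains an infinite open cluster. -/
def HasInfiniteCluster (adj : Site → Site → Prop) (ω : Config) : Prop :=
  ∃ x, InInfiniteCluster adj ω x

/-- The configuration corresponding to `η : Site → Bool`. -/
def toConfig (η : Site → Bool) : Config := {x | η x = true}

/-- A cylinder event. -/
def cylinder (F : Finset Site) (b : Site → Bool) : Set (Site → Bool) :=
  {η | ∀ x ∈ F, η x = b x}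

/-- `μ` is the Bernoulli product measure with density `p` of open sites. -/
def IsBernoulli (p : ℝ) (μ : Measure (Site → Bool)) : Prop :=
  IsProbabilityMeasure μ ∧
    ∀ (F : Finset Site) (b : Site → Bool),
      μ (cylinder F b) = ∏ x ∈ F, ENNReal.ofReal (if b x then p else 1 - p)

/-- The percolation probability `θ`: the probability that the origin lies in an
infinite open cluster. -/
noncomputable def theta (adj : Site → Site → Prop) (μ : Measure (Site → Bool)) : ℝ :=
  (μ {η | InInfiniteCluster adj (toConfig η) 0}).toReal

/-- The percolation probability of the enhanced process (`μ` the law of the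
configuration, `ν` the law of the activation variables). -/
noncomputable def thetaEnh (adj : Site → Site → Prop) (φ : Config → Config)
    (μ ν : Measure (Site → Bool)) : ℝ :=
  ((μ.prod ν) {ηα | InInfiniteCluster adj (enhanced φ (toConfig ηα.1) ηα.2) 0}).toReal

/-- The critical point `p_c = sup {p ∈ [0,1] : θ(p) = 0}` for the family `P`. -/
noncomputable def pcOf (adj : Site → Site → Prop) (P : ℝ → Measure (Site → Bool)) : ℝ :=
  sSup {p | p ∈ Icc (0:ℝ) 1 ∧ theta adj (P p) = 0}

/-- The connectivity function `τ_p(x)`. -/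
noncomputable def tau (adj : Site → Site → Prop) (μ : Measure (Site → Bool)) (x : Site) : ℝ :=
  (μ {η | ConnectedIn adj (toConfig η) 0 x}).toReal

/-- The connectivity function `τ_{p,s}(x)` of the enhanced process. -/
noncomputable def tauEnh (adj : Site → Site → Prop) (φ : Config → Config)
    (μ ν : Measure (Site → Bool)) (x : Site) : ℝ :=
  ((μ.prod ν) {ηα | ConnectedIn adj (enhanced φ (toConfig ηα.1) ηα.2) 0 x}).toReal

/-- The mean cluster size `χ(p) = E_p‖C‖ = ∑_x τ_p(x)`. -/
noncomputable def chi (adj : Site → Site → Prop) (μ : Measure (Site → Bool)) : ℝ≥0∞ :=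
  ∑' x : Site, μ {η | ConnectedIn adj (toConfig η) 0 x}

/-- The mean cluster size of the enhanced process. -/
noncomputable def chiEnh (adj : Site → Site → Prop) (φ : Config → Config)
    (μ ν : Measure (Site → Bool)) : ℝ≥0∞ :=
  ∑' x : Site, (μ.prod ν) {ηα | ConnectedIn adj (enhanced φ (toConfig ηα.1) ηα.2) 0 x}


/-- A closed `*`-path in `ω`: a finite sequence of distinct sites, consecutive ones
`*`-adjacent, all of whose sites are closed. -/
def ClosedStarPath (ω : Config) (l : List Site) : Prop :=
  l ≠ [] ∧ l.Nodup ∧ l.Chain' adjStar ∧ ∀ z ∈ l, z ∉ ω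

/-- A site `x` is protected in `ω` (with `R = 2R₀`): it is closed and there are two
closed `*`-paths starting at `x`, whose last sites lie outside `B_x(2R)`, and which
apart from `x` are disjoint and mutually non-`*`-adjacent. -/
def ProtectedSite (R : ℝ) (ω : Config) (x : Site) : Prop :=
  x ∉ ω ∧ ∃ l₁ l₂ : List Site,
    ClosedStarPath ω l₁ ∧ ClosedStarPath ω l₂ ∧
    l₁.head? = some x ∧ l₂.head? = some x ∧
    (∃ z, l₁.getLast? = some z ∧ 2 * R < siteNorm (z - x)) ∧
    (∃ z, l₂.getLast? = some z ∧ 2 * R < siteNorm (z - x)) ∧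
    ∀ z ∈ l₁, ∀ w ∈ l₂, z ≠ x → w ≠ x → z ≠ w ∧ ¬ adjStar z w

/-- Euclidean distance in the plane. -/
noncomputable def eudist (u v : ℝ × ℝ) : ℝ :=
  Real.sqrt ((u.1 - v.1) ^ 2 + (u.2 - v.2) ^ 2)

/-- The embedding of a site into the plane. -/
def toPlane (x : Site) : ℝ × ℝ := ((x.1 : ℝ), (x.2 : ℝ))

/-! ### Graph preliminaries -/

/-- The subgraph of `G` of all edges with both ends in `T`, on the full vertex set. -/
def restrictTo {V : Type*} (G : SimpleGraph V) (T : Set V) : SimpleGraph V where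
  Adj u v := G.Adj u v ∧ u ∈ T ∧ v ∈ T
  symm := ⟨fun _ _ h => ⟨h.1.symm, h.2.2, h.2.1⟩⟩
  loopless := ⟨fun _ h => h.1.ne rfl⟩

lemma mem_of_reachable_restrictTo {V : Type*} {G : SimpleGraph V} {T : Set V} {u v : V}
    (h : (restrictTo G T).Reachable u v) (hu : u ∈ T) : v ∈ T := by
  obtain ⟨w⟩ := h
  induction w with
  | nil => exact hu
  | cons hadj _ ih => exact ih hadj.2.2

lemma dist_le_succ_of_adj {V : Type*} {G : SimpleGraph V} (u : V) {v w : V} (h : G.Adj v w) :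
    G.dist u w ≤ G.dist u v + 1 := by
  rcases h.diff_dist_adj (u := u) with h | h | h <;> omega

lemma dist_getVert_of_geodesic {V : Type*} {G : SimpleGraph V} {u v : V} (p : G.Walk u v)
    (hp : p.length = G.dist u v) {i : ℕ} (hi : i ≤ p.length) : G.dist u (p.getVert i) = i := by
  have h1 := SimpleGraph.dist_le (p.take i)
  have h2 := SimpleGraph.dist_le (p.drop i)
  have h3 : G.dist u v ≤ G.dist u (p.getVert i) + G.dist (p.getVert i) v :=
    SimpleGraph.Reachable.dist_triangle_left ⟨p.take i⟩ v
  rw [SimpleGraph.Walk.take_length] at h1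
  rw [SimpleGraph.Walk.drop_length] at h2
  omega

/-- An infinite component of a locally finite graph contains a geodesic ray from any of its
vertices. -/
lemma exists_geodesic_ray {V : Type*} (G : SimpleGraph V) (hG : ∀ v, {w | G.Adj v w}.Finite)
    (p : V) (hp : {w | G.Reachable p w}.Infinite) :
    ∃ γ : ℕ → V, γ 0 = p ∧ (∀ n, G.Adj (γ n) (γ (n + 1))) ∧ ∀ n, G.dist p (γ n) = n := by
  let D : V → Set V := fun v => {w | G.Reachable v w ∧ G.dist p w = G.dist p v + G.dist v w}
  have hD : (D p).Infinite := by
    refine hp.mono fun w hw => ⟨hw, ?_⟩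
    simp
  have step : ∀ v : {v // (D v).Infinite}, ∃ u : {v // (D v).Infinite},
      G.Adj v u ∧ G.dist p u = G.dist p v + 1 := by
    rintro ⟨v, hv⟩
    by_contra! hcon
    have hsub : D v ⊆ insert v (⋃ u ∈ {u | G.Adj v u ∧ G.dist p u = G.dist p v + 1}, D u) := by
      intro w hw
      obtain ⟨hr, hd⟩ := hw
      obtain ⟨q, hq⟩ := hr.exists_walk_length_eq_dist
      cases q with
      | nil => exact Set.mem_insert _ _
      | @cons _ u _ hadj q =>
        right
        rw [SimpleGraph.Walk.length_cons] at hq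
        have h1 := SimpleGraph.dist_le q
        have h2 := dist_le_succ_of_adj p hadj
        have h3 : G.dist p w ≤ G.dist p u + G.dist u w :=
          SimpleGraph.Reachable.dist_triangle_right ⟨q⟩ p
        simp only [Set.mem_iUnion]
        exact ⟨u, ⟨hadj, by omega⟩, ⟨q⟩, by omega⟩
    refine hv (Set.Finite.subset (Set.Finite.insert _ (Set.Finite.biUnion ?_ ?_)) hsub)
    · exact (hG v).subset fun u hu => hu.1
    · intro u hu
      by_contra hinf
      exact hcon ⟨u, hinf⟩ hu.1 hu.2
  choose f hf1 hf2 using step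
  let g : ℕ → {v // (D v).Infinite} := fun n => f^[n] ⟨p, hD⟩
  have hg : ∀ n, g (n + 1) = f (g n) := fun n => Function.iterate_succ_apply' f n _
  refine ⟨fun n => g n, rfl, fun n => ?_, fun n => ?_⟩
  · simp only [hg]
    exact hf1 _
  · induction n with
    | zero => simp [g]
    | succ n ih => simp only [hg, hf2, ih]

lemma exists_eq_of_unit_steps (g : ℕ → ℕ) (hinj : Function.Injective g)
    (hstep : ∀ k, g (k + 1) ≤ g k + 1) {m : ℕ} (hm : g 0 ≤ m) : ∃ k, g k = m := by
  have hunb : ∃ k, m ≤ g k := by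
    by_contra! hcon
    exact (Set.infinite_range_of_injective hinj)
      ((Set.finite_Iio m).subset (by rintro _ ⟨k, rfl⟩; exact hcon k))
  classical
  have hspec := Nat.find_spec hunb
  have hmin := fun k => Nat.find_min hunb (m := k)
  generalize Nat.find hunb = k at hspec hmin
  refine ⟨k, ?_⟩
  cases k with
  | zero => omega
  | succ k =>
    have := hmin k (by omega)
    have := hstep k
    omega

/-- A doubly infinite injective path is not contained in the union of a finite set and one
chordless ray. -/
lemma not_biinfinite_of_ray {V : Type*} (R : V → V → Prop) (δ : ℤ → V) (hδ : Function.Injective δ)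
    (hstep : ∀ i, R (δ i) (δ (i + 1))) (F : Set V) (hF : F.Finite) (γ : ℕ → V)
    (hγ : ∀ m n, R (γ m) (γ n) → m ≤ n + 1 ∧ n ≤ m + 1)
    (hsub : ∀ i, δ i ∈ F ∪ Set.range γ) : False := by
  obtain ⟨N, hN⟩ : ∃ N : ℕ, ∀ i : ℤ, N ≤ i.natAbs → δ i ∉ F := by
    have hfin : (δ ⁻¹' F).Finite := hF.preimage hδ.injOn
    obtain ⟨N, hN⟩ := (hfin.image (fun i => i.natAbs)).bddAbove
    refine ⟨N + 1, fun i hi hiF => ?_⟩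
    have := hN ⟨i, hiF, rfl⟩
    simp only at this
    omega
  have hex : ∀ i : ℤ, N ≤ i.natAbs → ∃ k, γ k = δ i := fun i hi => by
    rcases hsub i with h | h
    · exact absurd h (hN i hi)
    · exact h
  choose f hf using hex
  have hp : ∀ k : ℕ, N ≤ ((N : ℤ) + k).natAbs := fun k => by omega
  have hn : ∀ k : ℕ, N ≤ (-(N : ℤ) - 1 - k).natAbs := fun k => by omega
  let a : ℕ → ℕ := fun k => f _ (hp k)
  let b : ℕ → ℕ := fun k => f _ (hn k)
  have ha : ∀ k, γ (a k) = δ ((N : ℤ) + k) := fun k => hf _ _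
  have hb : ∀ k, γ (b k) = δ (-(N : ℤ) - 1 - k) := fun k => hf _ _
  have hainj : Function.Injective a := fun k l h => by
    have := hδ ((ha k).symm.trans ((congrArg γ h).trans (ha l)))
    omega
  have hbinj : Function.Injective b := fun k l h => by
    have := hδ ((hb k).symm.trans ((congrArg γ h).trans (hb l)))
    omega
  have hastep : ∀ k, a (k + 1) ≤ a k + 1 := fun k => by
    refine (hγ (a k) (a (k + 1)) ?_).2
    rw [ha, ha]
    convert hstep _ using 2
    push_cast
    ring
  have hbstep : ∀ k, b (k + 1) ≤ b k + 1 := fun k => by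
    refine (hγ (b (k + 1)) (b k) ?_).1
    rw [hb, hb]
    convert hstep _ using 2
    push_cast
    ring
  obtain ⟨k, hk⟩ := exists_eq_of_unit_steps a hainj hastep (le_max_left (a 0) (b 0))
  obtain ⟨l, hl⟩ := exists_eq_of_unit_steps b hbinj hbstep (le_max_right (a 0) (b 0))
  have := hδ ((ha k).symm.trans ((congrArg γ (hk.trans hl.symm)).trans (hb l)))
  omega

/-! ### Induced `*`-paths -/

/-- Two sites at `ℓ^∞`-distance at most one. -/
def near (u v : Site) : Prop :=
  u.1 ≤ v.1 + 1 ∧ v.1 ≤ u.1 + 1 ∧ u.2 ≤ v.2 + 1 ∧ v.2 ≤ u.2 + 1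

lemma near_comm {u v : Site} : near u v ↔ near v u := by
  unfold near
  tauto

lemma near_refl (u : Site) : near u u := by
  unfold near
  omega

lemma adjStar_iff {u v : Site} : adjStar u v ↔ u ≠ v ∧ near u v := by
  obtain ⟨a, b⟩ := u
  obtain ⟨c, d⟩ := v
  simp only [adjStar, near, ne_eq, Prod.mk.injEq]
  refine and_congr_right fun hne => ?_
  rcases abs_cases (a - c) with h | h <;> rcases abs_cases (b - d) with h' | h' <;>
    rcases max_cases |a - c| |b - d| with h'' | h'' <;> omega

lemma adjZ2_iff {u v : Site} : adjZ2 u v ↔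
    (u.1 = v.1 ∧ (u.2 = v.2 + 1 ∨ v.2 = u.2 + 1)) ∨
    (u.2 = v.2 ∧ (u.1 = v.1 + 1 ∨ v.1 = u.1 + 1)) := by
  simp only [adjZ2]
  rcases abs_cases (u.1 - v.1) with h | h <;> rcases abs_cases (u.2 - v.2) with h' | h' <;> omega

lemma adjZ2_near {u v : Site} (h : adjZ2 u v) : near u v := by
  rw [adjZ2_iff] at h
  unfold near
  omega

lemma finite_near (u : Site) : {v | near u v}.Finite := by
  refine ((Set.finite_Icc (u.1 - 1) (u.1 + 1)).prod (Set.finite_Icc (u.2 - 1) (u.2 + 1))).subset ?_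
  intro v hv
  simp only [near, Set.mem_ofPred_eq] at hv
  simp only [Set.mem_prod, Set.mem_Icc]
  omega

/-- The square lattice `ℤ²`. -/
def squareLattice : SimpleGraph Site where
  Adj := adjZ2
  symm := ⟨fun u v h => by rw [adjZ2_iff] at *; omega⟩
  loopless := ⟨fun u h => by rw [adjZ2_iff] at h; omega⟩

/-- The matching lattice of `ℤ²`. -/
def starLattice : SimpleGraph Site where
  Adj := adjStar
  symm := ⟨fun u v h => by rw [adjStar_iff] at *; exact ⟨h.1.symm, near_comm.1 h.2⟩⟩
  loopless := ⟨fun u h => h.1 rfl⟩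

/-- The sequence `q`, restricted to the indices in `[l, u]`, is an induced `*`-path. -/
def InducedOn (q : ℤ → Site) (l u : ℤ) : Prop :=
  ∀ i j, l ≤ i → i ≤ u → l ≤ j → j ≤ u → (near (q i) (q j) ↔ i ≤ j + 1 ∧ j ≤ i + 1)

lemma InducedOn.mono {q : ℤ → Site} {l u l' u' : ℤ} (h : InducedOn q l u) (hl : l ≤ l')
    (hu : u' ≤ u) : InducedOn q l' u' :=
  fun i j h1 h2 h3 h4 => h i j (by omega) (by omega) (by omega) (by omega)

/-- The doubly infinite sequence `Q` is an induced `*`-path. -/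
def Induced (Q : ℤ → Site) : Prop :=
  ∀ i j, near (Q i) (Q j) ↔ i ≤ j + 1 ∧ j ≤ i + 1

lemma Induced.reverse {Q : ℤ → Site} (hQ : Induced Q) : Induced fun i => Q (-i) := fun i j => by
  rw [hQ]
  omega

lemma Induced.injective {Q : ℤ → Site} (hQ : Induced Q) : Function.Injective Q := by
  intro i j h
  have h1 := (hQ i (j + 1)).1 (by rw [h, hQ]; omega)
  have h2 := (hQ i (j - 1)).1 (by rw [h, hQ]; omega)
  omega

/-! ### Local structure along an induced path -/

/-- The eight neighbours of the origin in the matching lattice, in counterclockwise order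
starting from `(1, 0)`. -/
def ring : ZMod 8 → Site :=
  ![(1, 0), (1, 1), (0, 1), (-1, 1), (-1, 0), (-1, -1), (0, -1), (1, -1)]

instance (u v : Site) : Decidable (near u v) := by
  unfold near
  infer_instance

/-- For a step in direction `d`, the direction from its first site to the square-lattice
neighbour of that site lying immediately to the left of the step. -/
def leftDir (d : ZMod 8) : ZMod 8 := if d.val % 2 = 0 then d + 2 else d + 1

lemma ring_adj_succ (k : ZMod 8) : adjZ2 (ring k) (ring (k + 1)) := by
  rw [adjZ2_iff]
  revert k
  decide

lemma ring_near (k : ZMod 8) : near 0 (ring k) := by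
  revert k
  decide

lemma ring_add_four (k : ZMod 8) : ring (k + 4) = -ring k := by
  revert k
  decide

lemma ring_leftDir (d : ZMod 8) : ring (leftDir d) = ring d + ring (d + 3) := by
  revert d
  decide

lemma adjZ2_ring_leftDir (d : ZMod 8) : adjZ2 0 (ring (leftDir d)) := by
  rw [adjZ2_iff]
  revert d
  decide

lemma near_ring_leftDir (d : ZMod 8) :
    near (ring d) (ring (leftDir d)) ∧ ring d ≠ ring (leftDir d) ∧ ring (leftDir d) ≠ 0 := by
  revert d
  decide

lemma exists_ring (u : Site) (h : near 0 u) (h0 : u ≠ 0) : ∃ k, u = ring k := by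
  obtain ⟨a, b⟩ := u
  simp only [near, Prod.fst_zero, Prod.snd_zero] at h
  obtain ⟨h1, h2, h3, h4⟩ := h
  have ha : a = -1 ∨ a = 0 ∨ a = 1 := by omega
  have hb : b = -1 ∨ b = 0 ∨ b = 1 := by omega
  clear h1 h2 h3 h4
  rcases ha with rfl | rfl | rfl <;> rcases hb with rfl | rfl | rfl <;>
    first
    | exact absurd rfl h0
    | decide

lemma ring_arc (a c t : ZMod 8) (h : ¬ near (ring a) (ring c))
    (ht : t.val ≤ (a - 1 - leftDir c).val) :
    ring (leftDir c + t) ≠ ring a ∧ ring (leftDir c + t) ≠ ring c := by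
  revert a c t
  decide

lemma near_add_left {w u v : Site} : near (w + u) (w + v) ↔ near u v := by
  simp only [near, Prod.fst_add, Prod.snd_add]
  omega

lemma adjZ2_add_left {w u v : Site} : adjZ2 (w + u) (w + v) ↔ adjZ2 u v := by
  simp only [adjZ2_iff, Prod.fst_add, Prod.snd_add]
  omega

lemma Induced.exists_dir {Q : ℤ → Site} (hQ : Induced Q) (i : ℤ) :
    ∃ k, Q (i + 1) = Q i + ring k := by
  obtain ⟨k, hk⟩ := exists_ring (Q (i + 1) - Q i) (by
    rw [← near_add_left (w := Q i)]
    simp only [add_zero, add_sub_cancel]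
    rw [hQ]
    omega) (by
    rw [sub_ne_zero]
    intro h
    have := hQ.injective h
    omega)
  exact ⟨k, by rw [← hk]; abel⟩

/-- The square-lattice graph on the sites off the path `Q`. -/
abbrev offPath (Q : ℤ → Site) : SimpleGraph Site := restrictTo squareLattice (Set.range Q)ᶜ

/-- The site immediately to the left of the `i`-th step of `Q`, where `d` lists the directions
of the steps of `Q`. -/
def leftSite (Q : ℤ → Site) (d : ℤ → ZMod 8) (i : ℤ) : Site := Q i + ring (leftDir (d i))

lemma adjZ2_leftSite (Q : ℤ → Site) (d : ℤ → ZMod 8) (i : ℤ) :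
    adjZ2 (Q i) (leftSite Q d i) := by
  have := adjZ2_add_left (w := Q i).2 (adjZ2_ring_leftDir (d i))
  rwa [add_zero] at this

lemma Induced.leftSite_notMem {Q : ℤ → Site} (hQ : Induced Q) {d : ℤ → ZMod 8}
    (hd : ∀ i, Q (i + 1) = Q i + ring (d i)) (i : ℤ) : leftSite Q d i ∈ (Set.range Q)ᶜ := by
  rintro ⟨j, hj⟩
  obtain ⟨h1, h2, h3⟩ := near_ring_leftDir (d i)
  have hn1 : near (Q i) (Q j) := hj ▸ adjZ2_near (adjZ2_leftSite Q d i)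
  have hn2 : near (Q (i + 1)) (Q j) := by
    rw [hj, hd, leftSite, near_add_left]
    exact h1
  rw [hQ] at hn1 hn2
  have : j = i ∨ j = i + 1 := by omega
  rcases this with rfl | rfl
  · rw [leftSite, left_eq_add] at hj
    exact h3 hj
  · rw [leftSite, hd, add_right_inj] at hj
    exact h2 hj

lemma Induced.reachable_leftSite_succ {Q : ℤ → Site} (hQ : Induced Q) {d : ℤ → ZMod 8}
    (hd : ∀ i, Q (i + 1) = Q i + ring (d i)) (i : ℤ) :
    (offPath Q).Reachable (leftSite Q d i) (leftSite Q d (i + 1)) := by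
  set w := Q (i + 1) with hw
  set c := d (i + 1) with hc
  set a := d i + 4 with ha
  have hprev : Q i = w + ring a := by
    rw [hw, ha, hd, ring_add_four]
    abel
  have hnext : Q (i + 1 + 1) = w + ring c := hd _
  have hac : ¬ near (ring a) (ring c) := by
    rw [← near_add_left (w := w), ← hprev, ← hnext, hQ]
    omega
  have hoff : ∀ k, ring k ≠ ring a → ring k ≠ ring c → w + ring k ∈ (Set.range Q)ᶜ := by
    rintro k hka hkc ⟨j, hj⟩
    have hn : near w (Q j) := by
      rw [hj]
      simpa using (near_add_left (w := w)).2 (ring_near k)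
    rw [hw, hQ] at hn
    have : j = i ∨ j = i + 1 ∨ j = i + 1 + 1 := by omega
    rcases this with rfl | rfl | rfl
    · rw [hprev, add_right_inj] at hj
      exact hka hj.symm
    · rw [← hw, left_eq_add] at hj
      exact absurd hj (by clear * -; revert k; decide)
    · rw [hnext, add_right_inj] at hj
      exact hkc hj.symm
  have hstart : leftSite Q d (i + 1) = w + ring (leftDir c) := rfl
  have hend : leftSite Q d i = w + ring (a - 1) := by
    have h3 : a - 1 = d i + 3 := by
      rw [ha]
      ring
    rw [h3, hw, hd, leftSite, ring_leftDir, add_assoc]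
  have hwalk : ∀ n : ℕ, n ≤ (a - 1 - leftDir c).val →
      (offPath Q).Reachable (w + ring (leftDir c)) (w + ring (leftDir c + (n : ZMod 8))) := by
    intro n
    induction n with
    | zero => simp
    | succ n ih =>
      intro hn
      refine (ih (by omega)).trans (SimpleGraph.Adj.reachable ?_)
      have hlt : (a - 1 - leftDir c).val < 8 := ZMod.val_lt _
      have hv1 : ((n : ZMod 8)).val = n := ZMod.val_cast_of_lt (by omega)
      have hv2 : (((n + 1 : ℕ) : ZMod 8)).val = n + 1 := ZMod.val_cast_of_lt (by omega)
      have h1 := ring_arc a c n hac (by rw [hv1]; omega)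
      have h2 := ring_arc a c (n + 1 : ℕ) hac (by rw [hv2]; omega)
      refine ⟨?_, hoff _ h1.1 h1.2, hoff _ h2.1 h2.2⟩
      have := ring_adj_succ (leftDir c + n)
      rw [add_assoc] at this
      push_cast
      exact adjZ2_add_left.2 this
  have := hwalk _ le_rfl
  rw [ZMod.natCast_zmod_val, add_sub_cancel] at this
  rw [hstart, hend]
  exact this.symm

lemma Induced.reachable_leftSite {Q : ℤ → Site} (hQ : Induced Q) {d : ℤ → ZMod 8}
    (hd : ∀ i, Q (i + 1) = Q i + ring (d i)) (i j : ℤ) :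
    (offPath Q).Reachable (leftSite Q d i) (leftSite Q d j) := by
  induction j using Int.inductionOn' (b := i) with
  | zero => exact SimpleGraph.Reachable.refl _
  | succ k _ ih => exact ih.trans (hQ.reachable_leftSite_succ hd k)
  | pred k _ ih =>
    refine ih.trans ?_
    have := hQ.reachable_leftSite_succ hd (k - 1)
    rw [sub_add_cancel] at this
    exact this.symm

lemma Induced.infinite_leftSite {Q : ℤ → Site} (hQ : Induced Q) (d : ℤ → ZMod 8) :
    (Set.range (leftSite Q d)).Infinite := by
  intro hfin
  refine (Set.infinite_range_of_injective hQ.injective) ?_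
  refine (hfin.biUnion fun u _ => finite_near u).subset ?_
  rintro _ ⟨i, rfl⟩
  simp only [Set.mem_iUnion]
  exact ⟨_, ⟨i, rfl⟩, near_comm.1 (adjZ2_near (adjZ2_leftSite Q d i))⟩

/-! ### Separation by a doubly infinite path -/

/-- The steps of `Q` which cross the vertical line between the columns `z.1` and `z.1 + 1`
below height `z.2`. -/
def crossings (Q : ℤ → Site) (z : Site) : Set ℤ :=
  {i | (((Q i).1 = z.1 ∧ (Q (i + 1)).1 = z.1 + 1) ∨ ((Q i).1 = z.1 + 1 ∧ (Q (i + 1)).1 = z.1)) ∧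
    (Q i).2 + (Q (i + 1)).2 < 2 * z.2}

/-- Every downward vertical half-line meets `Q` in finitely many steps. -/
def FiniteBelow (Q : ℤ → Site) : Prop := ∀ a b : ℤ, {i | (Q i).1 = a ∧ (Q i).2 < b}.Finite

lemma Induced.finite_crossings {Q : ℤ → Site} (hQ : Induced Q) (hfin : FiniteBelow Q) (z : Site) :
    (crossings Q z).Finite := by
  refine ((hfin z.1 (z.2 + 1)).union ((hfin z.1 (z.2 + 1)).preimage (f := fun i => i + 1)
    (add_left_injective 1).injOn)).subset ?_
  rintro i ⟨h1, h2⟩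
  have h := (hQ i (i + 1)).2 (by omega)
  unfold near at h
  simp only [Set.mem_union, Set.mem_ofPred_eq, Set.mem_preimage]
  omega

lemma even_ncard_boundary {S : Set ℤ} (hS : S.Finite) :
    Even {i : ℤ | ¬ (i ∈ S ↔ i + 1 ∈ S)}.ncard := by
  let T : Set ℤ := (fun i => i + 1) ⁻¹' S
  have hT : T.Finite := hS.preimage (add_left_injective 1).injOn
  have hcard : T.ncard = S.ncard :=
    Set.ncard_preimage_of_injective_subset_range (add_left_injective 1)
      (fun i _ => ⟨i - 1, by simp⟩)
  have heq : {i : ℤ | ¬ (i ∈ S ↔ i + 1 ∈ S)} = (S \ T) ∪ (T \ S) := by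
    ext i
    simp only [Set.mem_ofPred_eq, Set.mem_union, Set.mem_sdiff, T, Set.mem_preimage]
    tauto
  rw [heq, Set.ncard_union_eq (by
    rw [Set.disjoint_left]; exact fun i h1 h2 => h2.2 h1.1) hS.sdiff hT.sdiff]
  have h1 := Set.ncard_inter_add_ncard_sdiff_eq_ncard S T hS
  have h2 := Set.ncard_inter_add_ncard_sdiff_eq_ncard T S hT
  rw [Set.inter_comm] at h2
  exact ⟨(S \ T).ncard, by omega⟩

lemma Induced.even_crossings_of_adj {Q : ℤ → Site} (hQ : Induced Q) (hfin : FiniteBelow Q)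
    {z w : Site} (hz : z ∉ Set.range Q) (hw : w ∉ Set.range Q) (hadj : adjZ2 z w) :
    Even (crossings Q z).ncard ↔ Even (crossings Q w).ncard := by
  have hz' : ∀ i, Q i ≠ z := fun i h => hz ⟨i, h⟩
  have hw' : ∀ i, Q i ≠ w := fun i h => hw ⟨i, h⟩
  have hnear : ∀ i, near (Q i) (Q (i + 1)) := fun i => (hQ _ _).2 (by omega)
  simp only [ne_eq, Prod.ext_iff] at hz' hw'
  have vert : ∀ {z w : Site}, (∀ i, ¬ ((Q i).1 = z.1 ∧ (Q i).2 = z.2)) →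
      (∀ i, ¬ ((Q i).1 = w.1 ∧ (Q i).2 = w.2)) → z.1 = w.1 → w.2 = z.2 + 1 →
      crossings Q z = crossings Q w := by
    intro z w hz' hw' h1 h2
    ext i
    have a1 := hz' i
    have a2 := hz' (i + 1)
    have a3 := hw' i
    have a4 := hw' (i + 1)
    have a5 := hnear i
    unfold near at a5
    simp only [crossings, Set.mem_ofPred_eq]
    omega
  have horiz : ∀ {z w : Site}, (∀ i, ¬ ((Q i).1 = w.1 ∧ (Q i).2 = w.2)) → z.2 = w.2 →
      w.1 = z.1 + 1 → (Even (crossings Q z).ncard ↔ Even (crossings Q w).ncard) := by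
    intro z w hw' h1 h2
    have hev := even_ncard_boundary (hfin w.1 w.2)
    have heq : {i : ℤ | ¬ (i ∈ {i | (Q i).1 = w.1 ∧ (Q i).2 < w.2} ↔
        i + 1 ∈ {i | (Q i).1 = w.1 ∧ (Q i).2 < w.2})} = crossings Q z ∪ crossings Q w := by
      ext i
      have a3 := hw' i
      have a4 := hw' (i + 1)
      have a5 := hnear i
      unfold near at a5
      simp only [crossings, Set.mem_ofPred_eq, Set.mem_union]
      omega
    rw [heq, Set.ncard_union_eq ?_ (hQ.finite_crossings hfin z) (hQ.finite_crossings hfin w),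
      Nat.even_add] at hev
    · exact hev
    · rw [Set.disjoint_left]
      rintro i ⟨h3, -⟩ ⟨h4, -⟩
      omega
  rw [adjZ2_iff] at hadj
  rcases hadj with ⟨h1, h2 | h2⟩ | ⟨h1, h2 | h2⟩
  · rw [vert hw' hz' h1.symm h2]
  · rw [vert hz' hw' h1 h2]
  · exact (horiz hz' h1.symm h2).symm
  · exact horiz hw' h1 h2

lemma Induced.even_crossings_of_reachable {Q : ℤ → Site} (hQ : Induced Q) (hfin : FiniteBelow Q)
    {z w : Site} (h : (offPath Q).Reachable z w) :
    Even (crossings Q z).ncard ↔ Even (crossings Q w).ncard := by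
  obtain ⟨p⟩ := h
  induction p with
  | nil => rfl
  | cons hadj _ ih =>
    exact (hQ.even_crossings_of_adj hfin hadj.2.1 hadj.2.2 hadj.1).trans ih

lemma Induced.even_crossings_across {Q : ℤ → Site} (hQ : Induced Q) (hfin : FiniteBelow Q)
    {i₀ : ℤ} (h : Q i₀ = Q (i₀ + 1) + (1, 0)) :
    (Even (crossings Q (Q i₀ + (0, -1))).ncard ↔
      ¬ Even (crossings Q (Q (i₀ + 1) + (0, 1))).ncard) := by
  set a := (Q (i₀ + 1)).1 with ha
  set b := (Q (i₀ + 1)).2 with hb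
  have h1 : (Q i₀).1 = a + 1 := by rw [h]; simp [ha]
  have h2 : (Q i₀).2 = b := by rw [h]; simp [hb]
  have hz : Q i₀ + (0, -1) = (a + 1, b - 1) := by
    rw [Prod.ext_iff]; simp [h1, h2]; ring
  have hw : Q (i₀ + 1) + (0, 1) = (a, b + 1) := by
    rw [Prod.ext_iff]; simp [ha, hb]
  have key : ∀ j, near (Q i₀) (Q j) → near (Q (i₀ + 1)) (Q j) → j = i₀ ∨ j = i₀ + 1 := by
    intro j h3 h4
    rw [hQ] at h3 h4
    omega
  have keys : ∀ j, (Q j).1 = a ∨ (Q j).1 = a + 1 → b - 1 ≤ (Q j).2 → (Q j).2 ≤ b + 1 →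
      (j = i₀ ∨ j = i₀ + 1) := by
    intro j h3 h4 h5
    apply key <;> unfold near <;> omega
  have hoff : ∀ z : Site, (z.1 = a ∨ z.1 = a + 1) → (z.2 = b - 1 ∨ z.2 = b + 1) →
      z ∉ Set.range Q := by
    rintro z h3 h4 ⟨j, rfl⟩
    rcases keys j h3 (by omega) (by omega) with rfl | rfl <;> omega
  rw [hz, hw, ← hQ.even_crossings_of_adj hfin (hoff (a, b - 1) (by simp) (by simp))
    (hoff (a + 1, b - 1) (by simp) (by simp)) (by rw [adjZ2_iff]; simp)]
  have heq : crossings Q (a, b + 1) = insert i₀ (crossings Q (a, b - 1)) := by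
    ext i
    have hnear := (hQ i (i + 1)).2 (by omega)
    have k1 := keys i
    have k2 := keys (i + 1)
    unfold near at hnear
    simp only [crossings, Set.mem_ofPred_eq, Set.mem_insert_iff]
    by_cases hi : i = i₀
    · subst hi
      omega
    · have hi' : i = i₀ + 1 → (Q i).1 = a ∧ (Q i).2 = b := by rintro rfl; exact ⟨rfl, rfl⟩
      have hi'' : i + 1 = i₀ → (Q (i + 1)).1 = a + 1 ∧ (Q (i + 1)).2 = b := by
        rintro h; rw [h]; exact ⟨h1, h2⟩
      have hii : i + 1 = i₀ → i + 1 + 1 = i₀ + 1 := by omega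
      have hA : ¬ (i = i₀ + 1 ∧ i + 1 = i₀) := by omega
      omega
  have hni : i₀ ∉ crossings Q (a, b - 1) := by
    simp only [crossings, Set.mem_ofPred_eq]
    omega
  rw [heq, Set.ncard_insert_of_notMem hni (hQ.finite_crossings hfin _), Nat.even_add_one, not_not]

/-- From every site of an induced doubly infinite path `Q` there starts a chordless ray of the
square lattice running along the left of `Q`. -/
lemma Induced.exists_left_ray {Q : ℤ → Site} (hQ : Induced Q) {d : ℤ → ZMod 8}
    (hd : ∀ i, Q (i + 1) = Q i + ring (d i)) (m j : ℤ) :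
    ∃ γ : ℕ → Site, γ 0 = Q m ∧ (∀ n, (offPath Q).Reachable (leftSite Q d j) (γ (n + 1))) ∧
      (∀ n, adjZ2 (γ n) (γ (n + 1))) ∧ Function.Injective γ ∧
      ∀ a b, adjZ2 (γ a) (γ b) → a ≤ b + 1 ∧ b ≤ a + 1 := by
  let T : Set Site := insert (Q m) {z | (offPath Q).Reachable (leftSite Q d j) z}
  have hmem : ∀ i, leftSite Q d i ∈ T := fun i => Or.inr (hQ.reachable_leftSite hd j i)
  have hsub : ∀ z, (offPath Q).Reachable (leftSite Q d j) z →
      (restrictTo squareLattice T).Reachable (leftSite Q d j) z := by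
    rintro z ⟨p⟩
    have : ∀ u v : Site, (p : (offPath Q).Walk u v) →
        (offPath Q).Reachable (leftSite Q d j) u → (restrictTo squareLattice T).Reachable u v := by
      intro u v p
      induction p with
      | nil => exact fun _ => SimpleGraph.Reachable.refl _
      | @cons u w v hadj _ ih =>
        intro hu
        have hw := hu.trans hadj.reachable
        have huw : (restrictTo squareLattice T).Adj u w := ⟨hadj.1, Or.inr hu, Or.inr hw⟩
        exact huw.reachable.trans (ih hw)
    exact this _ _ p (SimpleGraph.Reachable.refl _)
  have hm : (restrictTo squareLattice T).Adj (Q m) (leftSite Q d m) :=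
    ⟨adjZ2_leftSite Q d m, Set.mem_insert _ _, hmem m⟩
  have hstart : ∀ z, (offPath Q).Reachable (leftSite Q d j) z →
      (restrictTo squareLattice T).Reachable (Q m) z := fun z hz =>
    (hm.reachable.trans (hsub _ (hQ.reachable_leftSite hd j m)).symm).trans (hsub z hz)
  obtain ⟨γ, h0, hadj, hdist⟩ := exists_geodesic_ray (restrictTo squareLattice T)
    (fun v => (finite_near v).subset fun w hw => adjZ2_near hw.1) (Q m)
    ((hQ.infinite_leftSite d).mono (by
      rintro _ ⟨i, rfl⟩
      exact hstart _ (hQ.reachable_leftSite hd j i)))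
  have hinj : Function.Injective γ := fun a b hab => by rw [← hdist a, hab, hdist b]
  refine ⟨γ, h0, fun n => ?_, fun n => (hadj n).1, hinj, fun a b hab => ?_⟩
  · rcases (hadj n).2.2 with h | h
    · rw [← h0] at h
      exact absurd (hinj h) (by omega)
    · exact h
  · have hT : ∀ n, γ n ∈ T := fun n => (hadj n).2.1
    have hab' : (restrictTo squareLattice T).Adj (γ a) (γ b) := ⟨hab, hT a, hT b⟩
    have h1 := dist_le_succ_of_adj (Q m) hab'
    have h2 := dist_le_succ_of_adj (Q m) hab'.symm
    rw [hdist, hdist] at h1 h2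
    exact ⟨h2, h1⟩

lemma HasDISRPath.mono {adj : Site → Site → Prop} {ω ω' : Config} (h : ω ⊆ ω')
    (hω : HasDISRPath adj ω) : HasDISRPath adj ω' := by
  obtain ⟨γ, h1, h2, h3⟩ := hω
  exact ⟨γ, h1, fun i => h (h2 i), h3⟩

/-- A site of a doubly infinite induced `*`-path is pivotal for the existence of a doubly infinite
self-repelling path in a suitable configuration that, in any given finite set, only leaves
sites of the `*`-path closed. -/
lemma Induced.exists_pivotal_config {Q : ℤ → Site} (hQ : Induced Q) (hfin : FiniteBelow Q)
    {i₀ : ℤ} (hi₀ : Q i₀ = Q (i₀ + 1) + (1, 0)) (F : Set Site) (hF : F.Finite) (m : ℤ) :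
    ∃ ω : Config, F \ Set.range Q ⊆ ω ∧ ¬ HasDISRPath adjZ2 ω ∧
      HasDISRPath adjZ2 (insert (Q m) ω) := by
  obtain ⟨d, hd⟩ := Classical.axiomOfChoice hQ.exists_dir
  obtain ⟨d', hd'⟩ := Classical.axiomOfChoice hQ.reverse.exists_dir
  have hrange : Set.range (fun i => Q (-i)) = Set.range Q :=
    (Equiv.neg ℤ).surjective.range_comp Q
  have hoff : offPath (fun i => Q (-i)) = offPath Q := by
    unfold offPath
    rw [hrange]
  obtain ⟨γ, γ0, γreach, γadj, γinj, γchord⟩ := hQ.exists_left_ray hd m i₀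
  obtain ⟨η, η0, ηreach, ηadj, ηinj, ηchord⟩ :=
    hQ.reverse.exists_left_ray hd' (-m) (-(i₀ + 1))
  rw [neg_neg] at η0
  rw [hoff] at ηreach
  have hl : leftSite Q d i₀ = Q i₀ + (0, -1) := by
    have h1 : ring (d i₀) = (-1, 0) := by
      rw [← add_right_inj (Q i₀), ← hd, hi₀, add_assoc]
      simp
    have h2 : d i₀ = 4 := by
      revert h1
      generalize d i₀ = k
      revert k
      decide
    rw [leftSite, h2]
    rfl
  have hr : leftSite (fun i => Q (-i)) d' (-(i₀ + 1)) = Q (i₀ + 1) + (0, 1) := by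
    have h1 : ring (d' (-(i₀ + 1))) = (1, 0) := by
      have := hd' (-(i₀ + 1))
      simp only [neg_neg] at this
      rw [← add_right_inj (Q (i₀ + 1)), ← this, ← hi₀]
      congr 1
      ring
    have h2 : d' (-(i₀ + 1)) = 0 := by
      revert h1
      generalize d' (-(i₀ + 1)) = k
      revert k
      decide
    rw [leftSite, h2, neg_neg]
    rfl
  rw [hl] at γreach
  rw [hr] at ηreach
  have hside := hQ.even_crossings_across hfin hi₀
  have hγside := fun n => hQ.even_crossings_of_reachable hfin (γreach n)
  have hηside := fun n => hQ.even_crossings_of_reachable hfin (ηreach n)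
  have hγoff : ∀ n, γ (n + 1) ∈ (Set.range Q)ᶜ := fun n =>
    mem_of_reachable_restrictTo (γreach n) (hl ▸ hQ.leftSite_notMem hd i₀)
  have hηoff : ∀ n, η (n + 1) ∈ (Set.range Q)ᶜ := fun n =>
    mem_of_reachable_restrictTo (ηreach n)
      (hr ▸ hrange ▸ hQ.reverse.leftSite_notMem hd' (-(i₀ + 1)))
  let ω : Config := (F \ Set.range Q) ∪ Set.range (fun n => γ (n + 1)) ∪
    Set.range (fun n => η (n + 1))
  have hωoff : ∀ z ∈ ω, z ∉ Set.range Q := by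
    rintro z ((hz | ⟨n, rfl⟩) | ⟨n, rfl⟩)
    · exact hz.2
    · exact hγoff n
    · exact hηoff n
  have hcross : ∀ a b, γ (a + 1) ≠ η (b + 1) ∧ ¬ adjZ2 (γ (a + 1)) (η (b + 1)) := by
    intro a b
    have h1 := hγside a
    have h2 := hηside b
    constructor
    · intro h
      rw [h] at h1
      tauto
    · intro h
      have := hQ.even_crossings_of_adj hfin (hγoff a) (hηoff b) h
      tauto
  refine ⟨ω, fun z hz => Or.inl (Or.inl hz), ?_, ?_⟩
  · rintro ⟨δ, δinj, δmem, δadj⟩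
    have hstep : ∀ i, adjZ2 (δ i) (δ (i + 1)) := fun i => (δadj _ _).2 (Or.inl rfl)
    have hconst : ∀ i, Even (crossings Q (δ i)).ncard ↔ Even (crossings Q (δ 0)).ncard := by
      have hs := fun i => hQ.even_crossings_of_adj hfin (hωoff _ (δmem i))
        (hωoff _ (δmem (i + 1))) (hstep i)
      intro i
      induction i using Int.inductionOn' (b := 0) with
      | zero => rfl
      | succ k _ ih => exact (hs k).symm.trans ih
      | pred k _ ih =>
        have := hs (k - 1)
        rw [sub_add_cancel] at this
        exact this.trans ih
    by_cases hc : Even (crossings Q (δ 0)).ncard ↔ Even (crossings Q (Q i₀ + (0, -1))).ncard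
    · refine not_biinfinite_of_ray adjZ2 δ δinj hstep F hF γ γchord fun i => ?_
      rcases δmem i with (h | ⟨n, h⟩) | ⟨n, h⟩
      · exact Or.inl h.1
      · exact Or.inr ⟨n + 1, h⟩
      · have h1 := hηside n
        have h2 := hconst i
        simp only at h
        rw [h] at h1
        tauto
    · refine not_biinfinite_of_ray adjZ2 δ δinj hstep F hF η ηchord fun i => ?_
      rcases δmem i with (h | ⟨n, h⟩) | ⟨n, h⟩
      · exact Or.inl h.1
      · have h1 := hγside n
        have h2 := hconst i
        simp only at h
        rw [h] at h1
        tauto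
      · exact Or.inr ⟨n + 1, h⟩
  · have hsymm : ∀ {u v}, adjZ2 u v → adjZ2 v u := fun h => squareLattice.symm.symm _ _ h
    have γiff : ∀ a b, adjZ2 (γ a) (γ b) ↔ a = b + 1 ∨ b = a + 1 := by
      refine fun a b => ⟨fun h => ?_, ?_⟩
      · have h1 := γchord a b h
        have h2 : a ≠ b := by
          rintro rfl
          exact squareLattice.loopless.irrefl _ h
        omega
      · rintro (rfl | rfl)
        · exact hsymm (γadj _)
        · exact γadj _
    have ηiff : ∀ a b, adjZ2 (η a) (η b) ↔ a = b + 1 ∨ b = a + 1 := by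
      refine fun a b => ⟨fun h => ?_, ?_⟩
      · have h1 := ηchord a b h
        have h2 : a ≠ b := by
          rintro rfl
          exact squareLattice.loopless.irrefl _ h
        omega
      · rintro (rfl | rfl)
        · exact hsymm (ηadj _)
        · exact ηadj _
    let π : ℤ → Site := fun i => if 0 ≤ i then γ i.toNat else η (-i).toNat
    have hπγ : ∀ n : ℕ, π n = γ n := fun n => by simp [π]
    have hπη : ∀ n : ℕ, π (-n) = η n := fun n => by
      rcases n with _ | n
      · simp [π, γ0, η0]
      · have : ¬ (0 : ℤ) ≤ -((n + 1 : ℕ) : ℤ) := by omega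
        simp only [π, if_neg this, neg_neg, Int.toNat_natCast]
    have hcases : ∀ i : ℤ, ∃ n : ℕ, i = n ∨ (i = -(n + 1 : ℕ)) := fun i => by
      rcases le_or_gt 0 i with h | h
      · exact ⟨i.toNat, Or.inl (by omega)⟩
      · exact ⟨(-i).toNat - 1, Or.inr (by omega)⟩
    refine ⟨π, fun i j hij => ?_, fun i => ?_, fun i j => ?_⟩
    · obtain ⟨a, rfl | rfl⟩ := hcases i <;> obtain ⟨b, rfl | rfl⟩ := hcases j
      · rw [hπγ, hπγ] at hij
        rw [γinj hij]
      · rw [hπγ, hπη] at hij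
        rcases a with _ | a
        · rw [γ0, ← η0] at hij
          have := ηinj hij
          omega
        · exact absurd hij (hcross _ _).1
      · rw [hπγ, hπη] at hij
        rcases b with _ | b
        · rw [γ0, ← η0] at hij
          have := ηinj hij
          omega
        · exact absurd hij.symm (hcross _ _).1
      · rw [hπη, hπη] at hij
        rw [ηinj hij]
    · obtain ⟨a, rfl | rfl⟩ := hcases i
      · rw [hπγ]
        rcases a with _ | a
        · exact Or.inl γ0
        · exact Or.inr (Or.inl (Or.inr ⟨a, rfl⟩))
      · rw [hπη]
        exact Or.inr (Or.inr ⟨a, rfl⟩)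
    · obtain ⟨a, rfl | rfl⟩ := hcases i <;> obtain ⟨b, rfl | rfl⟩ := hcases j
      · rw [hπγ, hπγ, γiff]
        omega
      · rw [hπγ, hπη]
        rcases a with _ | a
        · rw [γ0, ← η0, ηiff]
          omega
        · refine ⟨fun h => absurd h (hcross _ _).2, fun h => ?_⟩
          omega
      · rw [hπγ, hπη]
        rcases b with _ | b
        · rw [γ0, ← η0, ηiff]
          omega
        · refine ⟨fun h => absurd (hsymm h) (hcross _ _).2, fun h => ?_⟩
          omega
      · rw [hπη, hπη, ηiff]
        omega


/-! ### Pivotal sites of a path crossing a box -/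

/-- The sites at `ℓ^∞`-distance at most `r` from the origin. -/
def box (r : ℤ) : Set Site := {z | -r ≤ z.1 ∧ z.1 ≤ r ∧ -r ≤ z.2 ∧ z.2 ≤ r}

lemma finite_box (r : ℤ) : (box r).Finite := by
  refine ((Set.finite_Icc (-r) r).prod (Set.finite_Icc (-r) r)).subset fun z hz => ?_
  obtain ⟨h1, h2, h3, h4⟩ := hz
  exact ⟨⟨h1, h2⟩, h3, h4⟩

/-- Some configuration, containing all sites of `box r` off the stretch of `q` with indices strictly
between `l` and `u`, has no doubly infinite self-repelling path but acquires one when `z` is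
opened. -/
def Pivotal (r : ℤ) (q : ℤ → Site) (l u : ℤ) (z : Site) : Prop :=
  ∃ ω : Config, box r \ q '' Set.Ioo l u ⊆ ω ∧ ¬ HasDISRPath adjZ2 ω ∧
    HasDISRPath adjZ2 (insert z ω)

lemma pivotal_of_straight {r : ℤ} {q : ℤ → Site} {l m u : ℤ} (hlm : l < m)
    (hmu : m < u) (hq : InducedOn q l u) (hin : ∀ i, l < i → i < u → q i ∈ box r)
    (hl : (q l).1 = r + 1) (e : Site)
    (he : (e = (1, 0) ∧ (q u).1 = r + 1) ∨ (e = (-1, 0) ∧ (q u).1 = -(r + 1)) ∨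
      (e = (0, 1) ∧ (q u).2 = r + 1)) : Pivotal r q l u (q m) := by
  have hm := hin m hlm hmu
  have hl1 := (hq l (l + 1) (by omega) (by omega) (by omega) (by omega)).2 (by omega)
  have hu1 := (hq u (u - 1) (by omega) (by omega) (by omega) (by omega)).2 (by omega)
  have hl2 := hin (l + 1) (by omega) (by omega)
  have hu2 := hin (u - 1) (by omega) (by omega)
  have hlu := mt (hq l u (by omega) (by omega) (by omega) (by omega)).1 (by omega)
  simp only [box, Set.mem_ofPred_eq] at hin hm hl2 hu2
  let Q : ℤ → Site := fun i =>
    if i < l then ((q l).1 + (l - i), (q l).2) else if i ≤ u then q i else q u + (i - u) • e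
  have Q1 : ∀ i, i < l → (Q i).1 = r + 1 + (l - i) ∧ (Q i).2 = (q l).2 := fun i hi => by
    simp [Q, hi, hl]
  have Q2 : ∀ i, l ≤ i → i ≤ u → Q i = q i := fun i h1 h2 => by
    simp [Q, h1.not_gt, h2]
  have Q3 : ∀ i, u < i → (Q i).1 = (q u).1 + (i - u) * e.1 ∧ (Q i).2 = (q u).2 + (i - u) * e.2 :=
    fun i h1 => by
    have h2 : ¬ i < l := by omega
    simp [Q, h2, h1.not_ge]
  unfold near at hl1 hu1 hlu
  have Q4 : ∀ i, u < i → (((Q i).1 = r + 1 + (i - u) ∧ (q u).1 = r + 1 ∧ (Q i).2 = (q u).2) ∨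
      ((Q i).1 = -(r + 1) - (i - u) ∧ (q u).1 = -(r + 1) ∧ (Q i).2 = (q u).2) ∨
      ((Q i).2 = r + 1 + (i - u) ∧ (q u).2 = r + 1 ∧ (Q i).1 = (q u).1)) := fun i hi => by
    obtain ⟨h1, h2⟩ := Q3 i hi
    rcases he with ⟨rfl, h⟩ | ⟨rfl, h⟩ | ⟨rfl, h⟩ <;> simp only at h1 h2 <;> omega
  have hind : Induced Q := by
    have key : ∀ i j, i ≤ j → (near (Q i) (Q j) ↔ j ≤ i + 1) := by
      intro i j hij
      rcases lt_or_ge i l with hi | hi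
      · obtain ⟨a1, a2⟩ := Q1 i hi
        rcases lt_or_ge j l with hj | hj
        · obtain ⟨b1, b2⟩ := Q1 j hj
          unfold near
          omega
        rcases le_or_gt j u with hj' | hj'
        · rw [Q2 j hj hj']
          unfold near
          rcases hj.eq_or_lt with rfl | h
          · omega
          · rcases hj'.eq_or_lt with rfl | h'
            · omega
            · have := hin j h h'
              omega
        · rcases Q4 j hj' with h | h | h <;> unfold near <;> omega
      rcases le_or_gt i u with hi' | hi'
      · rw [Q2 i hi hi']
        rcases le_or_gt j u with hj' | hj'
        · rw [Q2 j (by omega) hj', hq i j (by omega) (by omega) (by omega) (by omega)]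
          omega
        · have := Q4 j hj'
          unfold near
          rcases hi'.eq_or_lt with rfl | h'
          · omega
          · rcases hi.eq_or_lt with rfl | h
            · omega
            · have := hin i h h'
              omega
      · have h1 := Q3 i hi'
        have h2 := Q3 j (by omega)
        unfold near
        rcases he with ⟨rfl, -⟩ | ⟨rfl, -⟩ | ⟨rfl, -⟩ <;> simp only at h1 h2 <;> omega
    intro i j
    rcases le_total i j with h | h
    · rw [key i j h]
      omega
    · rw [near_comm, key j i h]
      omega
  have hfin : FiniteBelow Q := by
    intro a b
    refine (Set.finite_Icc (l - r - 1 - a.natAbs) (u + a.natAbs + b.natAbs + r + 1)).subset ?_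
    intro i hi
    simp only [Set.mem_ofPred_eq] at hi
    rw [Set.mem_Icc]
    rcases lt_or_ge i l with h | h
    · have := Q1 i h
      omega
    rcases le_or_gt i u with h' | h'
    · omega
    · have := Q4 i h'
      omega
  have hedge : Q (l - 1) = Q (l - 1 + 1) + (1, 0) := by
    rw [sub_add_cancel, Q2 l le_rfl (by omega)]
    have := Q1 (l - 1) (by omega)
    rw [Prod.ext_iff]
    simp only [Prod.fst_add, Prod.snd_add]
    omega
  obtain ⟨ω, h1, h2, h3⟩ := hind.exists_pivotal_config hfin hedge (box r) (finite_box r) m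
  rw [Q2 m hlm.le hmu.le] at h3
  refine ⟨ω, fun z hz => h1 ⟨hz.1, ?_⟩, h2, h3⟩
  rintro ⟨i, rfl⟩
  obtain ⟨hz, hz'⟩ := hz
  simp only [box, Set.mem_ofPred_eq] at hz
  refine hz' ⟨i, ?_⟩
  rcases lt_or_ge i l with h | h
  · have := Q1 i h
    omega
  rcases le_or_gt i u with h' | h'
  · rw [Q2 i h h'] at hz ⊢
    have hil : i ≠ l := by
      rintro rfl
      omega
    have hiu : i ≠ u := by
      rintro rfl
      omega
    exact ⟨⟨by omega, by omega⟩, rfl⟩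
  · have := Q4 i h'
    omega

lemma hasDISRPath_preimage {g : Site → Site} (hg : Function.Involutive g)
    (hadj : ∀ u v, adjZ2 (g u) (g v) ↔ adjZ2 u v) {ω : Config} :
    HasDISRPath adjZ2 (g ⁻¹' ω) ↔ HasDISRPath adjZ2 ω := by
  constructor
  · rintro ⟨γ, h1, h2, h3⟩
    exact ⟨g ∘ γ, hg.injective.comp h1, h2, fun i j => (hadj _ _).trans (h3 i j)⟩
  · rintro ⟨γ, h1, h2, h3⟩
    exact ⟨g ∘ γ, hg.injective.comp h1, fun i => by simpa [hg (γ i)] using h2 i,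
      fun i j => (hadj _ _).trans (h3 i j)⟩

lemma Pivotal.of_comp {g : Site → Site} (hg : Function.Involutive g)
    (hadj : ∀ u v, adjZ2 (g u) (g v) ↔ adjZ2 u v) {r : ℤ} (hbox : ∀ u ∈ box r, g u ∈ box r)
    {q : ℤ → Site} {l u : ℤ} {z : Site} (h : Pivotal r (g ∘ q) l u (g z)) : Pivotal r q l u z := by
  obtain ⟨ω, h1, h2, h3⟩ := h
  refine ⟨g ⁻¹' ω, fun w hw => h1 ⟨hbox w hw.1, ?_⟩, ?_, ?_⟩
  · rintro ⟨i, hi, h⟩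
    exact hw.2 ⟨i, hi, hg.injective h⟩
  · rwa [hasDISRPath_preimage hg hadj]
  · rw [← hasDISRPath_preimage hg hadj] at h3
    convert h3 using 1
    ext w
    simp [hg.injective.eq_iff]

lemma InducedOn.comp {g : Site → Site} (hg : ∀ u v, near (g u) (g v) ↔ near u v) {q : ℤ → Site}
    {l u : ℤ} (h : InducedOn q l u) : InducedOn (g ∘ q) l u :=
  fun i j h1 h2 h3 h4 => (hg _ _).trans (h i j h1 h2 h3 h4)

/-- Every site of an induced path crossing a box is pivotal for a suitable configuration. -/
lemma InducedOn.pivotal {r : ℤ} {q : ℤ → Site} {l m u : ℤ} (hlm : l < m)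
    (hmu : m < u) (hq : InducedOn q l u) (hin : ∀ i, l < i → i < u → q i ∈ box r)
    (hl : q l ∉ box r) (hu : q u ∉ box r) : Pivotal r q l u (q m) := by
  have right : ∀ {q : ℤ → Site}, InducedOn q l u → (∀ i, l < i → i < u → q i ∈ box r) →
      q u ∉ box r → (q l).1 = r + 1 → Pivotal r q l u (q m) := by
    intro q hq hin hu hl
    have hu1 := (hq u (u - 1) (by omega) (by omega) (by omega) (by omega)).2 (by omega)
    have hu2 := hin (u - 1) (by omega) (by omega)
    have : (q u).1 = r + 1 ∨ (q u).1 = -(r + 1) ∨ (q u).2 = r + 1 ∨ (q u).2 = -(r + 1) := by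
      simp only [near, box, Set.mem_ofPred_eq] at *
      omega
    rcases this with h | h | h | h
    · exact pivotal_of_straight hlm hmu hq hin hl (1, 0) (by simp [h])
    · exact pivotal_of_straight hlm hmu hq hin hl (-1, 0) (by simp [h])
    · exact pivotal_of_straight hlm hmu hq hin hl (0, 1) (by simp [h])
    · refine Pivotal.of_comp (g := fun z => (z.1, -z.2)) (fun z => by simp)
        (fun u v => by simp only [adjZ2_iff]; omega)
        (fun u hu => by simp only [box, Set.mem_ofPred_eq] at *; omega) ?_
      refine pivotal_of_straight hlm hmu (hq.comp fun u v => by simp only [near]; omega)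
        (fun i h1 h2 => ?_) hl (0, 1) (by simp [h])
      have := hin i h1 h2
      simp only [box, Set.mem_ofPred_eq, Function.comp_apply] at *
      omega
  have horiz : ∀ {q : ℤ → Site}, InducedOn q l u → (∀ i, l < i → i < u → q i ∈ box r) →
      q u ∉ box r → ((q l).1 = r + 1 ∨ (q l).1 = -(r + 1)) → Pivotal r q l u (q m) := by
    intro q hq hin hu hl
    rcases hl with hl | hl
    · exact right hq hin hu hl
    · have hbox : ∀ u : Site, ((-u.1, u.2) : Site) ∈ box r ↔ u ∈ box r := fun u => by
        simp only [box, Set.mem_ofPred_eq]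
        omega
      refine Pivotal.of_comp (g := fun z => (-z.1, z.2)) (fun z => by simp)
        (fun u v => by simp only [adjZ2_iff]; omega) (fun u hu => (hbox u).2 hu) ?_
      exact right (hq.comp fun u v => by simp only [near]; omega)
        (fun i h1 h2 => (hbox _).2 (hin i h1 h2)) (mt (hbox _).1 hu) (by simp [hl])
  have hl1 := (hq l (l + 1) (by omega) (by omega) (by omega) (by omega)).2 (by omega)
  have hl2 := hin (l + 1) (by omega) (by omega)
  have : ((q l).1 = r + 1 ∨ (q l).1 = -(r + 1)) ∨ ((q l).2 = r + 1 ∨ (q l).2 = -(r + 1)) := by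
    simp only [near, box, Set.mem_ofPred_eq] at *
    omega
  rcases this with h | h
  · exact horiz hq hin hu h
  · have hbox : ∀ u : Site, u.swap ∈ box r ↔ u ∈ box r := fun u => by
      simp only [box, Set.mem_ofPred_eq, Prod.fst_swap, Prod.snd_swap]
      tauto
    refine Pivotal.of_comp Prod.swap_swap
      (fun u v => by simp only [adjZ2_iff, Prod.fst_swap, Prod.snd_swap]; omega)
      (fun u hu => (hbox u).2 hu) ?_
    exact horiz (hq.comp fun u v => by simp only [near, Prod.fst_swap, Prod.snd_swap]; omega)
      (fun i h1 h2 => (hbox _).2 (hin i h1 h2)) (mt (hbox _).1 hu) h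

/-! ### Survival of induced closed paths -/

/-- Sites of an induced closed `*`-path with both ends outside the box `v + box r` are not opened
by the enhancement at `v`. -/
def Robust (r : ℤ) (φ : Config → Config) (ω : Config) : Prop :=
  ∀ ⦃q : ℤ → Site⦄ ⦃l m u : ℤ⦄ ⦃v : Site⦄, InducedOn q l u → (∀ i ∈ Set.Icc l u, q i ∉ ω) →
    q l - v ∉ box r → q u - v ∉ box r → m ∈ Set.Icc l u → q m ∉ enhAt φ v ω

lemma siteBall_subset_box {R₀ : ℝ} : siteBall R₀ ⊆ box ⌊R₀⌋ := by
  intro z hz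
  have hz' : siteNorm z ≤ R₀ := hz
  have h1 : |(z.1 : ℝ)| ≤ R₀ := (Real.abs_le_sqrt (by nlinarith)).trans hz'
  have h2 : |(z.2 : ℝ)| ≤ R₀ := (Real.abs_le_sqrt (by nlinarith)).trans hz'
  have key : ∀ a : ℤ, |(a : ℝ)| ≤ R₀ → -⌊R₀⌋ ≤ a ∧ a ≤ ⌊R₀⌋ := fun a ha => by
    have := Int.le_floor.2 ((Int.cast_abs (R := ℝ)).trans_le ha)
    rwa [abs_le] at this
  exact ⟨(key _ h1).1, (key _ h1).2, (key _ h2).1, (key _ h2).2⟩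

lemma sub_mem_box_of_mem_enhAt {R₀ : ℝ} {φ : Config → Config} (hφ : IsEnhancement R₀ φ)
    {ω : Config} {v z : Site} (hz : z ∈ enhAt φ v ω) : z - v ∈ box ⌊R₀⌋ := by
  obtain ⟨w, hw, rfl⟩ := hz
  simpa using siteBall_subset_box (hφ.2.1 _ hw)

lemma robust_of_nonessential {R₀ : ℝ} {φ : Config → Config} (hφ : IsEnhancement R₀ φ)
    (hmono : Monotonic φ) (hness : ¬ Essential adjZ2 φ) (ω : Config) : Robust ⌊R₀⌋ φ ω := by
  intro q l m u v hq hω hl hu hm hqm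
  have hbox := sub_mem_box_of_mem_enhAt hφ hqm
  obtain ⟨z, hz, hzm⟩ := hqm
  obtain rfl : z = q m - v := by simp [← hzm]
  obtain ⟨hlm, hmu⟩ := hm
  obtain ⟨l', ⟨hl1, hl2, hl3⟩, hl4⟩ := Int.exists_greatest_of_bdd
    (P := fun i => l ≤ i ∧ i ≤ m ∧ q i - v ∉ box ⌊R₀⌋) ⟨m, fun i h => h.2.1⟩ ⟨l, le_rfl, hlm, hl⟩
  obtain ⟨u', ⟨hu1, hu2, hu3⟩, hu4⟩ := Int.exists_least_of_bdd
    (P := fun i => m ≤ i ∧ i ≤ u ∧ q i - v ∉ box ⌊R₀⌋) ⟨m, fun i h => h.1⟩ ⟨u, hmu, le_rfl, hu⟩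
  have hin : ∀ i, l' < i → i < u' → q i - v ∈ box ⌊R₀⌋ := by
    intro i h1 h2
    by_contra h
    rcases le_total i m with him | him
    · exact h1.not_ge (hl4 i ⟨by omega, him, h⟩)
    · exact h2.not_ge (hu4 i ⟨him, by omega, h⟩)
  have hlm' : l' < m := hl2.lt_of_ne (by rintro rfl; exact hl3 hbox)
  have hmu' : m < u' := hu1.lt_of_ne (by rintro rfl; exact hu3 hbox)
  obtain ⟨ω', h1, h2, h3⟩ := InducedOn.pivotal (q := fun i => q i - v) hlm' hmu'
    ((hq.mono hl1 hu2).comp (g := fun z => z - v) fun a b => by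
      simp only [near, Prod.fst_sub, Prod.snd_sub]
      omega) hin hl3 hu3
  refine hness ⟨ω', h2, h3.mono (Set.insert_subset (Or.inr ?_) Set.subset_union_left)⟩
  rw [hφ.2.2 (shiftConfig v ω) (shiftConfig v ω ∩ siteBall R₀) (by simp)] at hz
  refine hmono _ _ (fun w hw => h1 ⟨siteBall_subset_box hw.2, ?_⟩) hz
  rintro ⟨i, hi, rfl⟩
  refine hω i ⟨hl1.trans hi.1.le, hi.2.le.trans hu2⟩ ?_
  simpa [shiftConfig] using hw.1

/-! ### Connections by `*`-paths -/

lemma reachable_of_near {T : Set Site} {u v : Site} (h : near u v) (hu : u ∈ T) (hv : v ∈ T) :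
    (restrictTo starLattice T).Reachable u v := by
  by_cases huv : u = v
  · rw [huv]
  · have : (restrictTo starLattice T).Adj u v := ⟨adjStar_iff.2 ⟨huv, h⟩, hu, hv⟩
    exact this.reachable

lemma InducedOn.reachable {T : Set Site} {q : ℤ → Site} {l u : ℤ} (hq : InducedOn q l u)
    (hT : ∀ i ∈ Set.Icc l u, q i ∈ T) {a b : ℤ} (ha : a ∈ Set.Icc l u) (hb : b ∈ Set.Icc l u) :
    (restrictTo starLattice T).Reachable (q a) (q b) := by
  have key : ∀ i, l ≤ i → i ≤ u → (restrictTo starLattice T).Reachable (q l) (q i) := by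
    intro i hi
    induction i, hi using Int.leInduction with
    | base => exact fun _ => SimpleGraph.Reachable.refl _
    | succ i hi ih =>
      intro hu
      refine (ih (by omega)).trans (reachable_of_near ?_ (hT _ ⟨hi, by omega⟩)
        (hT _ ⟨by omega, hu⟩))
      rw [hq i (i + 1) hi (by omega) (by omega) hu]
      omega
  exact (key a ha.1 ha.2).symm.trans (key b hb.1 hb.2)

lemma exists_inducedOn {T : Set Site} {a b : Site} (ha : a ∈ T)
    (h : (restrictTo starLattice T).Reachable a b) :
    ∃ (N : ℤ) (q : ℤ → Site), 0 ≤ N ∧ q 0 = a ∧ q N = b ∧ InducedOn q 0 N ∧ (∀ i, q i ∈ T) ∧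
      ∀ i ∈ Set.Ioc 0 N, q i ≠ a := by
  obtain ⟨p, hp⟩ := h.exists_walk_length_eq_dist
  have hdist : ∀ i : ℤ, i ≤ p.length →
      (restrictTo starLattice T).dist a (p.getVert i.toNat) = i.toNat := fun i hi =>
    dist_getVert_of_geodesic p hp (by omega)
  have hT : ∀ i : ℤ, p.getVert i.toNat ∈ T := fun i =>
    mem_of_reachable_restrictTo ⟨p.take i.toNat⟩ ha
  have hsucc : ∀ i j : ℤ, 0 ≤ i → i ≤ j → j ≤ p.length →
      (near (p.getVert i.toNat) (p.getVert j.toNat) ↔ j ≤ i + 1) := by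
    intro i j hi hij hj
    constructor
    · intro hn
      have h1 := hdist i (by omega)
      have h2 := hdist j hj
      by_cases he : p.getVert i.toNat = p.getVert j.toNat
      · rw [he] at h1
        omega
      · have hadj : (restrictTo starLattice T).Adj (p.getVert i.toNat) (p.getVert j.toNat) :=
          ⟨adjStar_iff.2 ⟨he, hn⟩, hT i, hT j⟩
        have := dist_le_succ_of_adj a hadj
        omega
    · intro hji
      rcases hij.eq_or_lt with rfl | hlt
      · exact near_refl _
      · obtain rfl : j = i + 1 := by omega
        have hadj := p.adj_getVert_succ (i := i.toNat) (by omega)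
        rw [show (i + 1).toNat = i.toNat + 1 by omega]
        exact (adjStar_iff.1 hadj.1).2
  refine ⟨p.length, fun i => p.getVert i.toNat, by omega, by simp, by simp, ?_, hT, ?_⟩
  · intro i j h1 h2 h3 h4
    rcases le_total i j with hij | hij
    · rw [hsucc i j h1 hij h4]
      omega
    · rw [near_comm, hsucc j i h3 hij h2]
      omega
  · rintro i ⟨h1, h2⟩ h
    have h3 := hdist i h2
    simp only at h
    rw [h, SimpleGraph.dist_self] at h3
    omega

lemma reachable_of_isChain {T : Set Site} {l : List Site} (hl : l.IsChain adjStar)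
    (hT : ∀ z ∈ l, z ∈ T) {x y : Site} (hx : l.head? = some x) (hy : l.getLast? = some y) :
    (restrictTo starLattice T).Reachable x y := by
  induction l generalizing x with
  | nil => simp at hx
  | cons a l ih =>
    obtain rfl : a = x := by simpa using hx
    cases l with
    | nil =>
      obtain rfl : a = y := by simpa using hy
      exact SimpleGraph.Reachable.refl _
    | cons b l =>
      rw [List.isChain_cons_cons] at hl
      have hab : (restrictTo starLattice T).Adj a b := ⟨hl.1, hT a (by simp), hT b (by simp)⟩
      refine hab.reachable.trans (ih hl.2 (fun z hz => hT z (List.mem_cons_of_mem _ hz)) rfl ?_)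
      rwa [List.getLast?_cons_cons] at hy

lemma exists_closedStarPath {ω : Config} {T : Set Site} (hT : ∀ z ∈ T, z ∉ ω) {x y : Site}
    (hx : x ∈ T) (h : (restrictTo starLattice T).Reachable x y) :
    ∃ l, ClosedStarPath ω l ∧ l.head? = some x ∧ l.getLast? = some y := by
  obtain ⟨p, hp⟩ := h.exists_isPath
  refine ⟨p.support, ⟨p.support_ne_nil, hp.support_nodup, ?_, ?_⟩, ?_, ?_⟩
  · exact p.isChain_adj_support.imp fun _ _ h => h.1
  · intro z hz
    exact hT z (mem_of_reachable_restrictTo ⟨p.takeUntil z hz⟩ hx)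
  · rw [← p.cons_tail_support, List.head?_cons]
  · rw [List.getLast?_eq_getLast_of_ne_nil p.support_ne_nil, p.getLast_support]

/-- `Γ`, on the indices in `[k₁, k₂]`, is an induced closed `*`-path through `x = Γ 0`, both ends of
which lie just outside the box `x + box s`. -/
structure IsArms (ω : Config) (x : Site) (s : ℤ) (Γ : ℤ → Site) (k₁ k₂ : ℤ) : Prop where
  nonpos : k₁ ≤ 0
  nonneg : 0 ≤ k₂
  center : Γ 0 = x
  induced : InducedOn Γ k₁ k₂
  closed : ∀ i ∈ Set.Icc k₁ k₂, Γ i ∉ ω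
  mem_box : ∀ i ∈ Set.Icc k₁ k₂, Γ i - x ∈ box (s + 1)
  left_notMem : Γ k₁ - x ∉ box s
  right_notMem : Γ k₂ - x ∉ box s

lemma ClosedStarPath.exists_arm {ω : Config} {l : List Site} (hl : ClosedStarPath ω l) {x z : Site}
    (hx : l.head? = some x) (hz : l.getLast? = some z) {s : ℤ} (hs : 0 ≤ s) (hzx : z - x ∉ box s) :
    ∃ (k : ℤ) (q : ℤ → Site), 0 < k ∧ q 0 = x ∧ InducedOn q 0 k ∧ (∀ i, q i ∈ l) ∧
      (∀ i ∈ Set.Ioc 0 k, q i ≠ x) ∧ (∀ i ∈ Set.Icc 0 k, q i - x ∈ box (s + 1)) ∧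
      q k - x ∉ box s := by
  obtain ⟨N, q, hN, h0, rfl, hq, hmem, hne⟩ := exists_inducedOn (T := {w | w ∈ l})
    (List.mem_of_mem_head? hx) (reachable_of_isChain hl.2.2.1 (fun w hw => hw) hx hz)
  obtain ⟨k, ⟨hk1, hk2, hk3⟩, hk4⟩ := Int.exists_least_of_bdd
    (P := fun i => 0 ≤ i ∧ i ≤ N ∧ q i - x ∉ box s) ⟨0, fun i h => h.1⟩ ⟨N, hN, le_rfl, hzx⟩
  have hin : ∀ i, 0 ≤ i → i < k → q i - x ∈ box s := fun i h1 h2 => by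
    by_contra h
    exact h2.not_ge (hk4 i ⟨h1, by omega, h⟩)
  have hk0 : 0 < k := hk1.lt_of_ne (by
    rintro rfl
    rw [h0, sub_self] at hk3
    exact hk3 ⟨by simpa, hs, by simpa, hs⟩)
  refine ⟨k, q, hk0, h0, hq.mono le_rfl hk2, hmem, fun i hi => hne i ⟨hi.1, hi.2.trans hk2⟩,
    fun i hi => ?_, hk3⟩
  rcases hi.2.eq_or_lt with rfl | h
  · have h1 := (hq i (i - 1) hk1 hk2 (by omega) (by omega)).2 (by omega)
    have h2 := hin (i - 1) (by omega) (by omega)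
    simp only [near, box, Set.mem_ofPred_eq, Prod.fst_sub, Prod.snd_sub] at *
    omega
  · have := hin i hi.1 h
    simp only [box, Set.mem_ofPred_eq] at *
    omega

lemma siteNorm_le_of_mem_box {s : ℤ} {z : Site} (hz : z ∈ box s) : siteNorm z ≤ 2 * s := by
  obtain ⟨h1, h2, h3, h4⟩ := hz
  rify at h1 h2 h3 h4
  refine Real.sqrt_le_iff.2 ⟨by linarith, ?_⟩
  nlinarith


lemma ProtectedSite.exists_isArms {R : ℝ} {ω : Config} {x : Site} (h : ProtectedSite R ω x)
    {s : ℤ} (hs : 0 ≤ s) (hsR : (s : ℝ) ≤ R) : ∃ Γ k₁ k₂, IsArms ω x s Γ k₁ k₂ := by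
  obtain ⟨-, l₁, l₂, hl₁, hl₂, hx₁, hx₂, ⟨z₁, hz₁, hn₁⟩, ⟨z₂, hz₂, hn₂⟩, hne⟩ := h
  have hout : ∀ z, 2 * R < siteNorm z → z ∉ box s := fun z hz hb => by
    have := siteNorm_le_of_mem_box hb
    linarith
  obtain ⟨a, p, ha, hp0, hp, hpl, hpx, hpb, hpa⟩ := hl₁.exists_arm hx₁ hz₁ hs (hout _ hn₁)
  obtain ⟨b, q, hb, hq0, hq, hql, hqx, hqb, hqu⟩ := hl₂.exists_arm hx₂ hz₂ hs (hout _ hn₂)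
  let Γ : ℤ → Site := fun i => if i ≤ 0 then p (-i) else q i
  have Γ1 : ∀ i, i ≤ 0 → Γ i = p (-i) := fun i hi => by simp [Γ, hi]
  have Γ2 : ∀ i, 0 ≤ i → Γ i = q i := fun i hi => by
    rcases hi.eq_or_lt with rfl | h
    · simp [Γ, hp0, hq0]
    · simp [Γ, h.not_ge]
  have hmix : ∀ i j, -a ≤ i → i < 0 → 0 < j → j ≤ b → ¬ near (Γ i) (Γ j) := by
    intro i j h1 h2 h3 h4 hn
    rw [Γ1 i h2.le, Γ2 j h3.le] at hn
    obtain ⟨h5, h6⟩ := hne _ (hpl (-i)) _ (hql j) (hpx _ ⟨by omega, by omega⟩) (hqx _ ⟨h3, h4⟩)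
    exact h6 (adjStar_iff.2 ⟨h5, hn⟩)
  refine ⟨Γ, -a, b, by omega, hb.le, by rw [Γ2 0 le_rfl, hq0], ?_, ?_, ?_, ?_, ?_⟩
  · have key : ∀ i j, -a ≤ i → i ≤ j → j ≤ b → (near (Γ i) (Γ j) ↔ j ≤ i + 1) := by
      intro i j h1 h2 h3
      rcases le_or_gt 0 i with hi | hi
      · rw [Γ2 i hi, Γ2 j (by omega), hq i j hi (by omega) (by omega) h3]
        omega
      rcases le_or_gt j 0 with hj | hj
      · rw [Γ1 i hi.le, Γ1 j hj, hp (-i) (-j) (by omega) (by omega) (by omega) (by omega)]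
        omega
      · have := hmix i j h1 hi hj h3
        simp only [this, false_iff]
        omega
    intro i j h1 h2 h3 h4
    rcases le_total i j with hij | hij
    · rw [key i j h1 hij h4]
      omega
    · rw [near_comm, key j i h3 hij h2]
      omega
  · rintro i ⟨h1, h2⟩
    rcases le_total i 0 with h | h
    · rw [Γ1 i h]
      exact hl₁.2.2.2 _ (hpl _)
    · rw [Γ2 i h]
      exact hl₂.2.2.2 _ (hql _)
  · rintro i ⟨h1, h2⟩
    rcases le_total i 0 with h | h
    · rw [Γ1 i h]
      exact hpb _ ⟨by omega, by omega⟩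
    · rw [Γ2 i h]
      exact hqb _ ⟨h, h2⟩
  · rw [Γ1 _ (by omega), neg_neg]
    exact hpa
  · rw [Γ2 _ hb.le]
    exact hqu

/-- A closed connection between `x` and `y` can be thinned out so as to resist all enhancements at
sites far from both `x` and `y`. -/
lemma Robust.exists_thinned {r : ℤ} {φ : Config → Config} {ω : Config} (hrob : Robust r φ ω)
    {T : Set Site} (hT : ∀ z ∈ T, z ∉ ω) {x y : Site} (hx : x ∈ T)
    (h : (restrictTo starLattice T).Reachable x y) :
    ∃ T' ⊆ T, x ∈ T' ∧ (restrictTo starLattice T').Reachable x y ∧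
      ∀ v, x - v ∉ box r → y - v ∉ box r → ∀ z ∈ T', z ∉ enhAt φ v ω := by
  obtain ⟨N, q, hN, rfl, rfl, hq, hmem, -⟩ := exists_inducedOn hx h
  have h0 : (0 : ℤ) ∈ Set.Icc 0 N := ⟨le_rfl, hN⟩
  refine ⟨q '' Set.Icc 0 N, ?_, Set.mem_image_of_mem q h0, ?_, ?_⟩
  · rintro _ ⟨i, -, rfl⟩
    exact hmem i
  · exact hq.reachable (fun i hi => Set.mem_image_of_mem q hi) h0 ⟨hN, le_rfl⟩
  · rintro v hxv hyv _ ⟨i, hi, rfl⟩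
    exact hrob hq (fun i _ => hT _ (hmem i)) hxv hyv hi

lemma sub_notMem_box {x v z : Site} {r : ℤ} (hxv : x - v ∈ box r)
    (hz : z - x ∉ box (2 * r)) : z - v ∉ box r := by
  simp only [box, Set.mem_ofPred_eq, Prod.fst_sub, Prod.snd_sub] at *
  omega

/-- A closed connection from `y` to a site `x` with arms can be modified, using the arms, so as to
resist all enhancements at sites close to `x` but not to `y`. -/
lemma IsArms.exists_rerouted {r : ℤ} {φ : Config → Config} {ω : Config} (hrob : Robust r φ ω)
    {x y : Site} {Γ : ℤ → Site} {k₁ k₂ : ℤ} (hΓ : IsArms ω x (2 * r) Γ k₁ k₂)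
    {T : Set Site} (hT : ∀ z ∈ T, z ∉ ω) (hy : y ∈ T)
    (h : (restrictTo starLattice T).Reachable y x) :
    ∃ T' ⊆ T ∪ Γ '' Set.Icc k₁ k₂, y ∈ T' ∧ (restrictTo starLattice T').Reachable y x ∧
      ∀ v, x - v ∈ box r → y - v ∉ box r → ∀ z ∈ T', z ∉ enhAt φ v ω := by
  obtain ⟨N, P, hN, rfl, hPN, hP, hmem, -⟩ := exists_inducedOn hy h
  have h0 : (0 : ℤ) ∈ Set.Icc k₁ k₂ := ⟨hΓ.nonpos, hΓ.nonneg⟩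
  obtain ⟨j, ⟨hj1, hj2, hj3⟩, hj4⟩ := Int.exists_least_of_bdd
    (P := fun j => 0 ≤ j ∧ j ≤ N ∧ ∃ i ∈ Set.Icc k₁ k₂, near (P j) (Γ i)) ⟨0, fun i h => h.1⟩
    ⟨N, hN, le_rfl, 0, h0, by rw [hPN, hΓ.center]; exact near_refl x⟩
  obtain ⟨i, ⟨⟨hi1, hi2⟩, hi3⟩, hi4⟩ := Int.exists_greatest_of_bdd
    (P := fun i => i ∈ Set.Icc k₁ k₂ ∧ near (P j) (Γ i)) ⟨k₂, fun i h => h.1.2⟩ hj3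
  have hΓT : ∀ i ∈ Set.Icc k₁ k₂, Γ i ∈ P '' Set.Icc 0 j ∪ Γ '' Set.Icc k₁ k₂ :=
    fun i hi => Or.inr ⟨i, hi, rfl⟩
  have hPT : ∀ i ∈ Set.Icc 0 j, P i ∈ P '' Set.Icc 0 j ∪ Γ '' Set.Icc k₁ k₂ :=
    fun i hi => Or.inl ⟨i, hi, rfl⟩
  have hPj := hP.mono le_rfl hj2
  have hj0 : (0 : ℤ) ∈ Set.Icc 0 j := ⟨le_rfl, hj1⟩
  have hjj : j ∈ Set.Icc 0 j := ⟨hj1, le_rfl⟩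
  refine ⟨P '' Set.Icc 0 j ∪ Γ '' Set.Icc k₁ k₂, ?_, hPT 0 hj0, ?_, ?_⟩
  · refine Set.union_subset_union_left _ ?_
    rintro _ ⟨k, -, rfl⟩
    exact hmem k
  · have h1 := hPj.reachable hPT hj0 hjj
    have h2 := hΓ.induced.reachable hΓT ⟨hi1, hi2⟩ h0
    rw [hΓ.center] at h2
    exact (h1.trans (reachable_of_near hi3 (hPT j hjj) (hΓT i ⟨hi1, hi2⟩))).trans h2
  · intro v hxv hyv
    have hl := sub_notMem_box hxv hΓ.left_notMem
    have hr := sub_notMem_box hxv hΓ.right_notMem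
    rintro _ (⟨m, ⟨hm1, hm2⟩, rfl⟩ | ⟨m, hm, rfl⟩)
    · let q : ℤ → Site := fun k => if k ≤ j then P k else Γ (i + (k - j - 1))
      have q1 : ∀ k, k ≤ j → q k = P k := fun k hk => by simp [q, hk]
      have q2 : ∀ k, j < k → q k = Γ (i + (k - j - 1)) := fun k hk => by simp [q, hk.not_ge]
      have hlast : q (j + 1 + (k₂ - i)) = Γ k₂ := by
        rw [q2 _ (by omega)]
        congr 1
        ring
      have hq : InducedOn q 0 (j + 1 + (k₂ - i)) := by
        have key : ∀ a b, 0 ≤ a → a ≤ b → b ≤ j + 1 + (k₂ - i) →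
            (near (q a) (q b) ↔ b ≤ a + 1) := by
          intro a b h1 h2 h3
          rcases le_or_gt b j with hb | hb
          · rw [q1 a (by omega), q1 b hb, hP a b h1 (by omega) (by omega) (by omega)]
            omega
          rcases lt_or_ge j a with ha | ha
          · rw [q2 a ha, q2 b hb, hΓ.induced _ _ (by omega) (by omega) (by omega) (by omega)]
            omega
          rw [q1 a ha, q2 b hb]
          rcases ha.eq_or_lt with rfl | ha'
          · constructor
            · intro hn
              have := hi4 _ ⟨⟨by omega, by omega⟩, hn⟩
              omega
            · intro hb'
              obtain rfl : b = a + 1 := by omega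
              simpa using hi3
          · refine ⟨fun hn => ?_, fun hb' => by omega⟩
            have := hj4 a ⟨h1, by omega, _, ⟨by omega, by omega⟩, hn⟩
            omega
        intro a b h1 h2 h3 h4
        rcases le_total a b with hab | hab
        · rw [key a b h1 hab h4]
          omega
        · rw [near_comm, key b a h3 hab h2]
          omega
      have hqω : ∀ k ∈ Set.Icc 0 (j + 1 + (k₂ - i)), q k ∉ ω := by
        rintro k ⟨h1, h2⟩
        rcases le_or_gt k j with hk | hk
        · rw [q1 k hk]
          exact hT _ (hmem k)
        · rw [q2 k hk]
          exact hΓ.closed _ ⟨by omega, by omega⟩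
      rw [← q1 m hm2]
      exact hrob hq hqω (by rwa [q1 0 hj1]) (by rwa [hlast]) ⟨hm1, by omega⟩
    · exact hrob hΓ.induced hΓ.closed hl hr hm

lemma sq_dist_of_disjoint_balls {R₀ : ℝ} (hR : 0 ≤ R₀) {x y : Site}
    (hballs : ∀ u : ℝ × ℝ, eudist u (toPlane x) ≤ 2 * (2 * R₀) →
      ¬ eudist u (toPlane y) ≤ 2 * (2 * R₀)) :
    64 * R₀ ^ 2 < ((x.1 : ℝ) - y.1) ^ 2 + ((x.2 : ℝ) - y.2) ^ 2 := by
  by_contra! hle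
  refine hballs (((x.1 : ℝ) + y.1) / 2, ((x.2 : ℝ) + y.2) / 2) ?_ ?_ <;>
    refine Real.sqrt_le_iff.2 ⟨by positivity, ?_⟩ <;> simp only [toPlane] <;> linarith

/-- let `φ` be a monotonic nonessential enhancement of range `R₀`
and set `R = 2R₀`. If `x` and `y` are protected, the balls `B_x(2R)` and `B_y(2R)`
are disjoint, and there is a closed `*`-path in `ω` from `x` to `y`, then there is a
closed `*`-path from `x` to `y` in the fully enhanced configuration `ω̃`. -/
theorem protected_connection_survives
    (R₀ : ℝ) (φ : Config → Config) (hφ : IsEnhancement R₀ φ)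
    (hmono : Monotonic φ) (hness : ¬ Essential adjZ2 φ)
    (ω : Config) (x y : Site)
    (hx : ProtectedSite (2 * R₀) ω x) (hy : ProtectedSite (2 * R₀) ω y)
    (hballs : ∀ u : ℝ × ℝ, eudist u (toPlane x) ≤ 2 * (2 * R₀) →
      ¬ eudist u (toPlane y) ≤ 2 * (2 * R₀))
    (l : List Site) (hl : ClosedStarPath ω l)
    (hlx : l.head? = some x) (hly : l.getLast? = some y) :
    ∃ l' : List Site, ClosedStarPath (fullyEnhanced φ ω) l' ∧
      l'.head? = some x ∧ l'.getLast? = some y := by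
  have hR := hφ.1
  have hr : 0 ≤ ⌊R₀⌋ := Int.floor_nonneg.2 hR
  have hrR : (⌊R₀⌋ : ℝ) ≤ R₀ := Int.floor_le R₀
  have hrob := robust_of_nonessential hφ hmono hness ω
  have hfar := sq_dist_of_disjoint_balls hR hballs
  have hbox : ∀ {v z}, z ∈ enhAt φ v ω → z - v ∈ box ⌊R₀⌋ := fun hz =>
    sub_mem_box_of_mem_enhAt hφ hz
  generalize ⌊R₀⌋ = r at *
  have hsR : ((2 * r : ℤ) : ℝ) ≤ 2 * R₀ := by
    push_cast
    linarith
  have hdist : 64 * r ^ 2 < (x.1 - y.1) ^ 2 + (x.2 - y.2) ^ 2 := by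
    have : (r : ℝ) ^ 2 ≤ R₀ ^ 2 := pow_le_pow_left₀ (by exact_mod_cast hr) hrR 2
    have : 64 * (r : ℝ) ^ 2 < (x.1 - y.1) ^ 2 + (x.2 - y.2) ^ 2 := by linarith
    exact_mod_cast this
  obtain ⟨Γ, k₁, k₂, hΓ⟩ := hx.exists_isArms (by omega) hsR
  obtain ⟨Δ, m₁, m₂, hΔ⟩ := hy.exists_isArms (by omega) hsR
  have hyl : y ∈ {z | z ∈ l} := List.mem_of_mem_getLast? hly
  obtain ⟨T₁, hT₁, hyT₁, hconn₁, hsurv₁⟩ := hΓ.exists_rerouted hrob hl.2.2.2 hyl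
    (reachable_of_isChain hl.2.2.1 (fun z hz => hz) hlx hly).symm
  have hclosed₁ : ∀ z ∈ T₁, z ∉ ω := fun z hz => by
    rcases hT₁ hz with h | ⟨i, hi, rfl⟩
    · exact hl.2.2.2 z h
    · exact hΓ.closed i hi
  have hxT₁ := mem_of_reachable_restrictTo hconn₁ hyT₁
  obtain ⟨T₂, hT₂, hxT₂, hconn₂, hsurv₂⟩ := hΔ.exists_rerouted hrob hclosed₁ hxT₁ hconn₁.symm
  have hclosed₂ : ∀ z ∈ T₂, z ∉ ω := fun z hz => by
    rcases hT₂ hz with h | ⟨i, hi, rfl⟩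
    · exact hclosed₁ z h
    · exact hΔ.closed i hi
  obtain ⟨T₃, hT₃, hxT₃, hconn₃, hsurv₃⟩ := hrob.exists_thinned hclosed₂ hxT₂ hconn₂
  refine exists_closedStarPath (T := T₃) (fun z hz hzω => ?_) hxT₃ hconn₃
  rcases hzω with hzω | ⟨v, hv⟩
  · exact hclosed₂ z (hT₃ hz) hzω
  by_cases hxv : x - v ∈ box r
  · by_cases hyv : y - v ∈ box r
    · simp only [box, Set.mem_ofPred_eq, Prod.fst_sub, Prod.snd_sub] at hxv hyv
      have h1 : |x.1 - y.1| ≤ 2 * r := abs_le.2 ⟨by omega, by omega⟩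
      have h2 : |x.2 - y.2| ≤ 2 * r := abs_le.2 ⟨by omega, by omega⟩
      have h3 := sq_le_sq' (abs_le.1 h1).1 (abs_le.1 h1).2
      have h4 := sq_le_sq' (abs_le.1 h2).1 (abs_le.1 h2).2
      nlinarith
    · rcases hT₂ (hT₃ hz) with h | ⟨i, hi, rfl⟩
      · exact hsurv₁ v hxv hyv z h hv
      · have hzv := hbox hv
        have hzy := hΔ.mem_box i hi
        have hr0 : r = 0 := by
          simp only [box, Set.mem_ofPred_eq, Prod.fst_sub, Prod.snd_sub] at hxv hzv hzy
          have h1 : |x.1 - y.1| ≤ 4 * r + 1 := abs_le.2 ⟨by omega, by omega⟩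
          have h2 : |x.2 - y.2| ≤ 4 * r + 1 := abs_le.2 ⟨by omega, by omega⟩
          have h3 := sq_le_sq' (abs_le.1 h1).1 (abs_le.1 h1).2
          have h4 := sq_le_sq' (abs_le.1 h2).1 (abs_le.1 h2).2
          by_contra hne
          have : 1 ≤ r := by omega
          nlinarith
        have hzx : Δ i = x := by
          simp only [box, Set.mem_ofPred_eq, Prod.fst_sub, Prod.snd_sub] at hxv hzv
          rw [Prod.ext_iff]
          omega
        rw [hzx] at hv
        exact hsurv₁ v hxv hyv x hxT₁ hv
  · by_cases hyv : y - v ∈ box r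
    · exact hsurv₂ v hyv hxv z (hT₃ hz) hv
    · exact hsurv₃ v hxv hyv z hz hv

end PercEnh
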